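/- arXiv:2211.14573 — 4 statements merged into one kernel-verified Lean document; each statement's English description precedes it below -/
import Mathlib

section
/- Let E be a real normed vector space, f : E ≃ E a bijection, and suppose that at every point x ∈ E the map f has Fréchet derivative given by a continuous linear equivalence A(x) : E ≃L E. Fix z ∈ E and u ∈ E. If δ : ℝ → E is a differentiable curve with δ(0) = z whose derivative at each time t equals (A(δ(t)))⁻¹(u), then δ(t) = f⁻¹(f(z) + t • u) for all t ∈ ℝ; that is, the DeCurvEd edit map is the unique flow of the pushforward vector field X(x) = (A(x))⁻¹(u). -/
/-- Remark 4 (uniqueness part): any differentiable curve starting at `z` that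
follows the pushforward vector field `X x = (A x)⁻¹ u` coincides with the
DeCurvEd edit curve `t ↦ f⁻¹ (f z + t • u)`. -/
theorem decurved_curve_unique_integral_curve
    {E : Type*} [NormedAddCommGroup E] [NormedSpace ℝ E]
    (f : E ≃ E) (A : E → (E ≃L[ℝ] E))
    (hf : ∀ x : E, HasFDerivAt f (A x : E →L[ℝ] E) x)
    (z u : E) (δ : ℝ → E) (hδ0 : δ 0 = z)
    (hδ : ∀ t : ℝ, HasDerivAt δ ((A (δ t)).symm u) t) :
    ∀ t : ℝ, δ t = f.symm (f z + t • u) := by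
  intro t
  have hg : ∀ s : ℝ, HasDerivAt (fun s : ℝ => f (δ s) - s • u) 0 s := fun s => by
    have h₁ : HasDerivAt (fun s : ℝ => f (δ s)) u s := by
      simpa [Function.comp_def] using (hf (δ s)).comp_hasDerivAt s (hδ s)
    have h₂ : HasDerivAt (fun s : ℝ => s • u) u s := by
      simpa using (hasDerivAt_id s).smul_const u
    simpa using h₁.fun_sub h₂
  have hconst : f (δ t) - t • u = f (δ 0) - (0 : ℝ) • u :=
    is_const_of_deriv_eq_zero (fun s => (hg s).differentiableAt) (fun s => (hg s).deriv) t 0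
  rw [Equiv.eq_symm_apply]
  rw [zero_smul, sub_zero, hδ0] at hconst
  exact sub_eq_iff_eq_add.mp hconst
end

section
/- Let E be a finite-dimensional real normed vector space and let X, Y : E → E be continuously differentiable vector fields admitting global flows φ, ψ : ℝ → E → E (so φ^0 = id, for each z the curve t ↦ φ^t(z) has derivative X(φ^t(z)), and similarly for ψ and Y). If the Lie bracket vanishes identically, i.e., DY(x)(X(x)) − DX(x)(Y(x)) = 0 for all x ∈ E, then the flows commute: φ^t ∘ ψ^s = ψ^s ∘ φ^t for all s, t ∈ ℝ. -/
open Set Filter Topology Metric Asymptotics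
open scoped NNReal

section

variable {E : Type*} [NormedAddCommGroup E] [NormedSpace ℝ E]

/-- A `C¹` map has a first-order Taylor expansion that is uniform over compact families of
base points and directions. -/
theorem ContDiff.eventually_norm_sub_sub_le_of_isCompact {α F : Type*} [TopologicalSpace α]
    [NormedAddCommGroup F] [NormedSpace ℝ F] {f : E → F} (hf : ContDiff ℝ 1 f)
    {γ V : α → E} (hγ : Continuous γ) (hV : Continuous V) {K : Set α} (hK : IsCompact K)
    {ε : ℝ} (hε : 0 < ε) :
    ∀ᶠ h in 𝓝 (0 : ℝ), ∀ a ∈ K,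
      ‖f (γ a + h • V a) - f (γ a) - h • fderiv ℝ f (γ a) (V a)‖ ≤ ε * ‖h‖ := by
  refine hK.eventually_forall_of_forall_eventually fun a _ => ?_
  have hcont : Tendsto (fun p : ℝ × α => (γ p.2 + p.1 • V p.2, γ p.2)) (𝓝 (0, a))
      (𝓝 (γ a, γ a)) := by
    have : Continuous fun p : ℝ × α => (γ p.2 + p.1 • V p.2, γ p.2) := by fun_prop
    simpa using this.tendsto (0, a)
  have hV1 : (fun p : ℝ × α => V p.2) =O[𝓝 (0, a)] fun _ => (1 : ℝ) :=
    ((hV.comp continuous_snd).tendsto (0, a)).isBigO_one ℝ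
  have hmul : (fun p : ℝ × α => p.1 • V p.2) =O[𝓝 (0, a)] fun p => p.1 := by
    simpa using (isBigO_refl (fun p : ℝ × α => p.1) (𝓝 (0, a))).smul hV1
  have hstrict : (fun p : ℝ × α => f (γ p.2 + p.1 • V p.2) - f (γ p.2)
      - fderiv ℝ f (γ a) (p.1 • V p.2)) =o[𝓝 (0, a)] fun p => p.1 := by
    have := (hf.hasStrictFDerivAt one_ne_zero (x := γ a)).isLittleO.comp_tendsto hcont
    simp only [Function.comp_def, add_sub_cancel_left] at this
    exact this.trans_isBigO hmul
  have hcoeff : (fun p : ℝ × α => fderiv ℝ f (γ a) (V p.2) - fderiv ℝ f (γ p.2) (V p.2))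
      =o[𝓝 (0, a)] fun _ => (1 : ℝ) := by
    rw [isLittleO_one_iff]
    have hd := hf.continuous_fderiv one_ne_zero
    have : Continuous fun p : ℝ × α =>
        fderiv ℝ f (γ a) (V p.2) - fderiv ℝ f (γ p.2) (V p.2) := by fun_prop
    simpa using this.tendsto (0, a)
  have hcorr : (fun p : ℝ × α => p.1 • (fderiv ℝ f (γ a) (V p.2) - fderiv ℝ f (γ p.2) (V p.2)))
      =o[𝓝 (0, a)] fun p => p.1 := by
    simpa using (isBigO_refl (fun p : ℝ × α => p.1) (𝓝 (0, a))).smul_isLittleO hcoeff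
  filter_upwards [(hstrict.add hcorr).def hε] with p hp
  have hsum : f (γ p.2 + p.1 • V p.2) - f (γ p.2) - fderiv ℝ f (γ a) (p.1 • V p.2)
      + p.1 • (fderiv ℝ f (γ a) (V p.2) - fderiv ℝ f (γ p.2) (V p.2))
      = f (γ p.2 + p.1 • V p.2) - f (γ p.2) - p.1 • fderiv ℝ f (γ p.2) (V p.2) := by
    rw [map_smul, smul_sub]
    abel
  rwa [hsum] at hp

/-- A Grönwall estimate for approximate trajectories of a vector field which is Lipschitz only on
a ball: if the Grönwall bound is less than `1`, a trajectory starting near an approximate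
trajectory lying well inside the ball cannot leave the ball. -/
theorem dist_le_gronwallBound_of_lipschitzOnWith_closedBall {X : E → E} {K : ℝ≥0} {R T δ ε : ℝ}
    (hX : LipschitzOnWith K X (closedBall 0 (R + 1))) {f g g' : ℝ → E} (hT : 0 ≤ T)
    (hδ : 0 ≤ δ) (hε : 0 ≤ ε)
    (hf : ∀ t, HasDerivAt f (X (f t)) t) (hg : ∀ t, HasDerivAt g (g' t) t)
    (hgR : ∀ t ∈ Icc 0 T, ‖g t‖ ≤ R) (hg' : ∀ t ∈ Icc 0 T, ‖g' t - X (g t)‖ ≤ ε)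
    (h0 : dist (f 0) (g 0) ≤ δ) (hsmall : gronwallBound δ K ε T < 1) :
    dist (f T) (g T) ≤ gronwallBound δ K ε T := by
  have hfc : Continuous f := continuous_iff_continuousAt.2 fun t => (hf t).continuousAt
  have hgc : Continuous g := continuous_iff_continuousAt.2 fun t => (hg t).continuousAt
  have key : ∀ b ∈ Icc 0 T, (∀ t ∈ Ico 0 b, dist (f t) (g t) ≤ 1) →
      dist (f b) (g b) ≤ gronwallBound δ K ε b := by
    intro b hb hclose
    have hsub : ∀ t ∈ Ico 0 b, t ∈ Icc 0 T := fun t ht => ⟨ht.1, ht.2.le.trans hb.2⟩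
    have := dist_le_of_approx_trajectories_ODE_of_mem (v := fun _ => X)
      (s := fun _ => closedBall 0 (R + 1)) (εf := 0) (εg := ε) (δ := δ) (a := 0) (b := b)
      (fun _ _ => hX) hfc.continuousOn
      (fun t _ => (hf t).hasDerivWithinAt) (fun t _ => by simp)
      (fun t ht => by
        have h1 := hclose t ht
        have h2 := hgR t (hsub t ht)
        rw [dist_eq_norm] at h1
        rw [mem_closedBall_zero_iff]
        have := norm_add_le (f t - g t) (g t)
        rw [sub_add_cancel] at this
        linarith)
      hgc.continuousOn (fun t _ => (hg t).hasDerivWithinAt)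
      (fun t ht => by simpa [dist_eq_norm] using hg' t (hsub t ht))
      (fun t ht => by
        rw [mem_closedBall_zero_iff]
        linarith [hgR t (hsub t ht)]) h0 b ⟨hb.1, le_rfl⟩
    simpa using this
  have hmono := gronwallBound_mono hδ hε K.coe_nonneg
  have hclose : ∀ t ∈ Icc 0 T, dist (f t) (g t) ≤ 1 := by
    by_contra! hfar
    obtain ⟨t, ht, hlt⟩ := hfar
    have hcompact : IsCompact (Icc 0 T ∩ {t | 1 ≤ dist (f t) (g t)}) :=
      isCompact_Icc.inter_right (isClosed_le continuous_const (hfc.dist hgc))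
    obtain ⟨b, ⟨hb, hb1⟩, hleast⟩ := hcompact.exists_isLeast ⟨t, ht, hlt.le⟩
    have hbound := key b hb fun t ht => by
      by_contra! hlt
      exact ht.2.not_ge (hleast ⟨⟨ht.1, ht.2.le.trans hb.2⟩, hlt.le⟩)
    have : (1 : ℝ) ≤ dist (f b) (g b) := hb1
    linarith [hmono hb.2]
  exact key T ⟨hT, le_rfl⟩ fun t ht => hclose t ⟨ht.1, ht.2.le⟩

theorem gronwallBound_mul (c δ K ε x : ℝ) :
    gronwallBound (c * δ) K (c * ε) x = c * gronwallBound δ K ε x := by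
  unfold gronwallBound
  split_ifs <;> ring

theorem le_gronwallBound {δ K ε x : ℝ} (hδ : 0 ≤ δ) (hK : 0 ≤ K) (hε : 0 ≤ ε) (hx : 0 ≤ x) :
    δ ≤ gronwallBound δ K ε x := by
  simpa only [gronwallBound_x0] using gronwallBound_mono hδ hε hK hx

variable [FiniteDimensional ℝ E]

theorem ContDiff.exists_lipschitzOnWith_closedBall {X : E → E} (hX : ContDiff ℝ 1 X) (R : ℝ) :
    ∃ K, LipschitzOnWith K X (closedBall 0 R) :=
  have := FiniteDimensional.proper_real E
  hX.locallyLipschitz.locallyLipschitzOn.exists_lipschitzOnWith_of_compact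
    (isCompact_closedBall 0 R)

/-- Global integral curves of a `C¹` vector field are determined by their initial value. -/
theorem ContDiff.integralCurve_unique {Y : E → E} (hY : ContDiff ℝ 1 Y) {f g : ℝ → E}
    (hf : ∀ t, HasDerivAt f (Y (f t)) t) (hg : ∀ t, HasDerivAt g (Y (g t)) t)
    (h0 : f 0 = g 0) : f = g := by
  funext t
  have hfc : Continuous f := continuous_iff_continuousAt.2 fun t => (hf t).continuousAt
  have hgc : Continuous g := continuous_iff_continuousAt.2 fun t => (hg t).continuousAt
  obtain ⟨A, hA⟩ := (isCompact_Icc (a := -(|t| + 1)) (b := |t| + 1)).exists_bound_of_continuousOn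
    hfc.continuousOn
  obtain ⟨B, hB⟩ := (isCompact_Icc (a := -(|t| + 1)) (b := |t| + 1)).exists_bound_of_continuousOn
    hgc.continuousOn
  obtain ⟨K, hK⟩ := hY.exists_lipschitzOnWith_closedBall (max A B)
  refine ODE_solution_unique_of_mem_Ioo (v := fun _ => Y) (t₀ := 0)
    (s := fun _ => closedBall 0 (max A B)) (a := -(|t| + 1)) (b := |t| + 1)
    (fun _ _ => hK) ?_
    (fun s hs => ⟨hf s, ?_⟩) (fun s hs => ⟨hg s, ?_⟩) h0 ?_
  · constructor <;> linarith [abs_nonneg t]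
  · exact mem_closedBall_zero_iff.2 ((hA s (Ioo_subset_Icc_self hs)).trans (le_max_left _ _))
  · exact mem_closedBall_zero_iff.2 ((hB s (Ioo_subset_Icc_self hs)).trans (le_max_right _ _))
  · constructor <;> linarith [neg_abs_le t, le_abs_self t]

/-- If `[X, Y] = 0`, then the time-`T` map of the flow of `X` carries curves tangent to `Y` at a
point to curves tangent to `Y` at the image point. -/
theorem hasDerivAt_flow_comp_of_lieBracket_eq_zero {X Y : E → E} (hX : ContDiff ℝ 1 X)
    (hY : ContDiff ℝ 1 Y) {φ : ℝ → E → E} (hφ0 : φ 0 = id)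
    (hφ : ∀ z t, HasDerivAt (fun t => φ t z) (X (φ t z)) t)
    (hbracket : ∀ x, fderiv ℝ Y x (X x) = fderiv ℝ X x (Y x))
    {c : ℝ → E} {s : ℝ} (hc : HasDerivAt c (Y (c s)) s) {T : ℝ} (hT : 0 ≤ T) :
    HasDerivAt (fun s => φ T (c s)) (Y (φ T (c s))) s := by
  set γ : ℝ → E := fun t => φ t (c s)
  have hγ : ∀ t, HasDerivAt γ (X (γ t)) t := hφ (c s)
  have hγ0 : γ 0 = c s := by simp [γ, hφ0]
  have hγc : Continuous γ := continuous_iff_continuousAt.2 fun t => (hγ t).continuousAt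
  have hYγ : Continuous fun t => Y (γ t) := hY.continuous.comp hγc
  obtain ⟨A, hA⟩ := (isCompact_Icc (a := 0) (b := T)).exists_bound_of_continuousOn
    hγc.continuousOn
  obtain ⟨B, hB⟩ := (isCompact_Icc (a := 0) (b := T)).exists_bound_of_continuousOn
    hYγ.continuousOn
  obtain ⟨K, hK⟩ := hX.exists_lipschitzOnWith_closedBall (A + B + 1)
  set G := gronwallBound 1 K 1 T
  have hG : 1 ≤ G := le_gronwallBound zero_le_one K.coe_nonneg zero_le_one hT
  rw [hasDerivAt_iff_isLittleO_nhds_zero] at hc ⊢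
  rw [isLittleO_iff]
  intro ε hε
  have hη : 0 < ε / G := by positivity
  have hsmall : ∀ᶠ h in 𝓝 (0 : ℝ), ε * ‖h‖ < 1 := by
    have : Continuous fun h : ℝ => ε * ‖h‖ := by fun_prop
    exact this.tendsto 0 |>.eventually_lt_const (by simp)
  have hle : ∀ᶠ h in 𝓝 (0 : ℝ), ‖h‖ ≤ 1 :=
    (continuous_norm.tendsto (0 : ℝ)).eventually_le_const (by simp)
  filter_upwards [hc.def hη, hsmall, hle,
    hX.eventually_norm_sub_sub_le_of_isCompact hγc hYγ (isCompact_Icc (a := 0) (b := T)) hη]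
    with h hch hh hh1 htaylor
  have hbound : gronwallBound (ε / G * ‖h‖) K (ε / G * ‖h‖) T = ε * ‖h‖ := by
    have := gronwallBound_mul (ε / G * ‖h‖) 1 K 1 T
    rw [mul_one] at this
    rw [this]
    change ε / G * ‖h‖ * G = _
    field_simp
  have hu : ∀ t, HasDerivAt (fun t => γ t + h • Y (γ t))
      (X (γ t) + h • fderiv ℝ Y (γ t) (X (γ t))) t := fun t =>
    (hγ t).add (((hY.differentiable one_ne_zero _).hasFDerivAt.comp_hasDerivAt t (hγ t)).const_smul h)
  have := dist_le_gronwallBound_of_lipschitzOnWith_closedBall (δ := ε / G * ‖h‖)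
    (ε := ε / G * ‖h‖) hK hT (by positivity) (by positivity) (hφ (c (s + h))) hu
    (fun t ht => by
      refine (norm_add_le _ _).trans (add_le_add (hA t ht) ?_)
      rw [norm_smul]
      exact (mul_le_of_le_one_left (norm_nonneg _) hh1).trans (hB t ht))
    (fun t ht => by
      rw [hbracket, norm_sub_rev, ← sub_sub]
      exact htaylor t ht)
    (by simpa [dist_eq_norm, hφ0, hγ0, sub_sub] using hch)
    (by rwa [hbound])
  rw [hbound, dist_eq_norm, ← sub_sub] at this
  exact this

theorem flow_comp_comm_of_lieBracket_eq_zero {X Y : E → E} (hX : ContDiff ℝ 1 X)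
    (hY : ContDiff ℝ 1 Y) {φ ψ : ℝ → E → E} (hφ0 : φ 0 = id)
    (hφ : ∀ z t, HasDerivAt (fun t => φ t z) (X (φ t z)) t) (hψ0 : ψ 0 = id)
    (hψ : ∀ z s, HasDerivAt (fun s => ψ s z) (Y (ψ s z)) s)
    (hbracket : ∀ x, fderiv ℝ Y x (X x) = fderiv ℝ X x (Y x)) (s : ℝ) {t : ℝ} (ht : 0 ≤ t) :
    φ t ∘ ψ s = ψ s ∘ φ t := by
  funext z
  have := hY.integralCurve_unique (f := fun s => φ t (ψ s z)) (g := fun s => ψ s (φ t z))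
    (fun s => hasDerivAt_flow_comp_of_lieBracket_eq_zero hX hY hφ0 hφ hbracket (hψ z s) ht)
    (hψ (φ t z)) (by simp [hψ0])
  exact congrFun this s

end


/-- Theorem 1 (one direction; Lee 9.44): on a finite-dimensional real normed
space, if two C¹ vector fields with global flows have vanishing Lie bracket,
then their flows commute. -/
theorem commuting_vector_fields_have_commuting_flows
    {E : Type*} [NormedAddCommGroup E] [NormedSpace ℝ E] [FiniteDimensional ℝ E]
    (X Y : E → E) (hX : ContDiff ℝ 1 X) (hY : ContDiff ℝ 1 Y)
    (φ ψ : ℝ → E → E)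
    (hφ0 : φ 0 = id)
    (hφ : ∀ (z : E) (t : ℝ), HasDerivAt (fun t => φ t z) (X (φ t z)) t)
    (hψ0 : ψ 0 = id)
    (hψ : ∀ (z : E) (s : ℝ), HasDerivAt (fun s => ψ s z) (Y (ψ s z)) s)
    (hbracket : ∀ x : E, fderiv ℝ Y x (X x) - fderiv ℝ X x (Y x) = 0) :
    ∀ (s t : ℝ), φ t ∘ ψ s = ψ s ∘ φ t := by
  intro s t
  have hbracket' : ∀ x, fderiv ℝ Y x (X x) = fderiv ℝ X x (Y x) := fun x =>
    sub_eq_zero.1 (hbracket x)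
  rcases le_total 0 t with ht | ht
  · exact flow_comp_comm_of_lieBracket_eq_zero hX hY hφ0 hφ hψ0 hψ hbracket' s ht
  · have := flow_comp_comm_of_lieBracket_eq_zero (X := -X) (φ := fun t => φ (-t)) hX.neg hY
      (by simpa using hφ0)
      (fun z t => by simpa [Function.comp_def] using (hφ z (-t)).scomp t (hasDerivAt_neg t))
      hψ0 hψ (fun x => by simp [fderiv_neg, hbracket']) s (neg_nonneg.2 ht)
    simpa using this
end

section
/- Let E be a finite-dimensional real normed vector space and let X, Y : E → E be continuously differentiable vector fields admitting global flows φ, ψ : ℝ → E → E (so φ^0 = id, for each z the curve t ↦ φ^t(z) has derivative X(φ^t(z)), and similarly for ψ and Y). If the flows commute, i.e., φ^t ∘ ψ^s = ψ^s ∘ φ^t for all s, t ∈ ℝ, then the Lie bracket vanishes identically: DY(x)(X(x)) − DX(x)(Y(x)) = 0 for all x ∈ E. -/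
open Filter Topology Set

/-- A flow of a vector field that is continuous at `x` is jointly continuous at `(0, x)` in
forward time. -/
theorem tendsto_flow_nhdsGE_prod_nhds {E : Type*} [NormedAddCommGroup E] [NormedSpace ℝ E]
    {X : E → E} {φ : ℝ → E → E} {x : E} (hX : ContinuousAt X x) (hφ0 : φ 0 = id)
    (hφ : ∀ (z : E) (t : ℝ), HasDerivAt (fun t => φ t z) (X (φ t z)) t) :
    Tendsto (fun p : ℝ × E => φ p.1 p.2) (𝓝[≥] 0 ×ˢ 𝓝 x) (𝓝 x) := by
  set M : ℝ := ‖X x‖ + 1 with hM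
  have hMpos : 0 < M := by positivity
  obtain ⟨r, hr, hXr⟩ := Metric.eventually_nhds_iff.1
    (hX.norm.eventually_lt continuousAt_const (show ‖X x‖ < M by simp [hM]))
  rw [Metric.tendsto_nhds]
  intro ε hε
  have hB : Tendsto (fun p : ℝ × E => ‖p.2 - x‖ + M * p.1) (𝓝[≥] 0 ×ˢ 𝓝 x) (𝓝 0) := by
    have hc : Continuous (fun p : ℝ × E => ‖p.2 - x‖ + M * p.1) := by fun_prop
    have := hc.tendsto (0, x)
    simp only [sub_self, norm_zero, mul_zero, add_zero, nhds_prod_eq] at this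
    exact this.mono_left (prod_mono_left _ nhdsWithin_le_nhds)
  have hge : ∀ᶠ p : ℝ × E in 𝓝[≥] 0 ×ˢ 𝓝 x, 0 ≤ p.1 :=
    tendsto_fst.eventually self_mem_nhdsWithin
  filter_upwards [hB.eventually_lt_const (lt_min hε hr), hge] with ⟨t, z⟩ hlt ht
  simp only at hlt ht ⊢
  have hbound := image_norm_le_of_norm_deriv_right_lt_deriv_boundary
    (f := fun τ => φ τ z - x) (f' := fun τ => X (φ τ z)) (a := 0) (b := t)
    (B := fun τ => ‖z - x‖ + M * τ) (B' := fun _ => M)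
    (fun τ _ => ((hφ z τ).sub_const x).continuousAt.continuousWithinAt)
    (fun τ _ => ((hφ z τ).sub_const x).hasDerivWithinAt)
    (by simp [hφ0])
    (fun τ => by simpa using ((hasDerivAt_id τ).const_mul M).const_add ‖z - x‖)
    (fun τ hτ heq => hXr (by
      rw [dist_eq_norm, heq]
      have := mul_le_mul_of_nonneg_left hτ.2.le hMpos.le
      linarith [min_le_right ε r]))
    (right_mem_Icc.2 ht)
  rw [dist_eq_norm]
  exact hbound.trans_lt (hlt.trans_le (min_le_left _ _))

/-- If a mixed partial derivative `Q = ∂ₛ∂ₜF` tends to `c` at the origin of the closed first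
quadrant, then the second difference of `F` over a square of side `h` is `h² c + o(h²)`. -/
theorem eventually_norm_second_difference_sub_le {E : Type*} [NormedAddCommGroup E]
    [NormedSpace ℝ E] {F P Q : ℝ → ℝ → E} {c : E}
    (hF : ∀ s t, HasDerivAt (fun t => F s t) (P s t) t)
    (hP : ∀ s t, HasDerivAt (fun s => P s t) (Q s t) s)
    (hQ : Tendsto (fun p : ℝ × ℝ => Q p.1 p.2) (𝓝[≥] 0 ×ˢ 𝓝[≥] 0) (𝓝 c))
    {ε : ℝ} (hε : 0 < ε) :
    ∀ᶠ h in 𝓝[>] (0 : ℝ),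
      ‖F h h - F 0 h - (F h 0 - F 0 0) - (h * h) • c‖ ≤ ε * (h * h) := by
  obtain ⟨U, hU, V, hV, hUV⟩ := mem_prod_iff.1 (Metric.tendsto_nhds.1 hQ ε hε)
  obtain ⟨δ, hδ, hδUV⟩ := mem_nhdsGE_iff_exists_Icc_subset.1 (inter_mem hU hV)
  filter_upwards [Ioo_mem_nhdsGT (mem_Ioi.1 hδ)] with h hh
  have hQc : ∀ s ∈ Icc 0 h, ∀ t ∈ Icc 0 h, ‖Q s t - c‖ ≤ ε := fun s hs t ht => by
    rw [← dist_eq_norm]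
    exact le_of_lt (hUV (mk_mem_prod (hδUV ⟨hs.1, hs.2.trans hh.2.le⟩).1
      (hδUV ⟨ht.1, ht.2.trans hh.2.le⟩).2))
  have hPc : ∀ t ∈ Icc 0 h, ‖P h t - P 0 t - h • c‖ ≤ ε * h := fun t ht => by
    have := norm_image_sub_le_of_norm_deriv_le_segment'
      (f := fun s => P s t - s • c) (f' := fun s => Q s t - c) (a := 0) (b := h)
      (fun s _ => by
        simpa using ((hP s t).fun_sub ((hasDerivAt_id s).smul_const c)).hasDerivWithinAt)
      (fun s hs => hQc s (Ico_subset_Icc_self hs) t ht) h (right_mem_Icc.2 hh.1.le)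
    simpa [sub_right_comm] using this
  have := norm_image_sub_le_of_norm_deriv_le_segment'
    (f := fun t => F h t - F 0 t - t • h • c) (f' := fun t => P h t - P 0 t - h • c)
    (a := 0) (b := h)
    (fun t _ => by
      simpa using (((hF h t).fun_sub (hF 0 t)).fun_sub
        ((hasDerivAt_id t).smul_const (h • c))).hasDerivWithinAt)
    (fun t ht => hPc t (Ico_subset_Icc_self ht)) h (right_mem_Icc.2 hh.1.le)
  simpa [sub_right_comm, smul_smul, mul_assoc] using this

/-- Symmetry of mixed partial derivatives, for iterated one-variable derivatives whose limits
at the origin exist along the closed first quadrant. -/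
theorem eq_of_tendsto_mixed_partials {E : Type*} [NormedAddCommGroup E] [NormedSpace ℝ E]
    {F P P' Q Q' : ℝ → ℝ → E} {c c' : E}
    (hF : ∀ s t, HasDerivAt (fun t => F s t) (P s t) t)
    (hP : ∀ s t, HasDerivAt (fun s => P s t) (Q s t) s)
    (hQ : Tendsto (fun p : ℝ × ℝ => Q p.1 p.2) (𝓝[≥] 0 ×ˢ 𝓝[≥] 0) (𝓝 c))
    (hF' : ∀ s t, HasDerivAt (fun s => F s t) (P' s t) s)
    (hP' : ∀ s t, HasDerivAt (fun t => P' s t) (Q' s t) t)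
    (hQ' : Tendsto (fun p : ℝ × ℝ => Q' p.1 p.2) (𝓝[≥] 0 ×ˢ 𝓝[≥] 0) (𝓝 c')) :
    c = c' := by
  refine eq_of_forall_dist_le fun ε hε => ?_
  have hswap : Tendsto (fun p : ℝ × ℝ => Q' p.2 p.1) (𝓝[≥] 0 ×ˢ 𝓝[≥] 0) (𝓝 c') :=
    hQ'.comp tendsto_prod_swap
  obtain ⟨h, ⟨h₁, h₂⟩, hpos⟩ :=
    (((eventually_norm_second_difference_sub_le hF hP hQ (half_pos hε)).and
      (eventually_norm_second_difference_sub_le (F := fun t s => F s t)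
        (P := fun t s => P' s t) (Q := fun t s => Q' s t) (fun t s => hF' s t)
        (fun t s => hP' s t) hswap (half_pos hε))).and self_mem_nhdsWithin).exists
  have hhpos : 0 < h * h := mul_pos hpos hpos
  have key := (norm_sub_le _ _).trans (add_le_add h₂ h₁)
  rw [show F h h - F h 0 - (F 0 h - F 0 0) - (h * h) • c' -
      (F h h - F 0 h - (F h 0 - F 0 0) - (h * h) • c) = (h * h) • (c - c') by
    rw [smul_sub]; abel, norm_smul, Real.norm_of_nonneg hhpos.le] at key
  rw [dist_eq_norm]
  exact le_of_mul_le_mul_left (by linarith) hhpos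


/-- Theorem 1 (converse direction; Lee 9.44): on a finite-dimensional real
normed space, if the global flows of two C¹ vector fields commute, then the
Lie bracket of the vector fields vanishes identically. -/
theorem commuting_flows_have_commuting_vector_fields
    {E : Type*} [NormedAddCommGroup E] [NormedSpace ℝ E] [FiniteDimensional ℝ E]
    (X Y : E → E) (hX : ContDiff ℝ 1 X) (hY : ContDiff ℝ 1 Y)
    (φ ψ : ℝ → E → E)
    (hφ0 : φ 0 = id)
    (hφ : ∀ (z : E) (t : ℝ), HasDerivAt (fun t => φ t z) (X (φ t z)) t)
    (hψ0 : ψ 0 = id)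
    (hψ : ∀ (z : E) (s : ℝ), HasDerivAt (fun s => ψ s z) (Y (ψ s z)) s)
    (hcomm : ∀ (s t : ℝ), φ t ∘ ψ s = ψ s ∘ φ t) :
    ∀ x : E, fderiv ℝ Y x (X x) - fderiv ℝ X x (Y x) = 0 := by
  intro x
  have hcomm' : ∀ s t, φ t (ψ s x) = ψ s (φ t x) := fun s t => congrFun (hcomm s t) x
  have hψx : Tendsto (fun s => ψ s x) (𝓝[≥] 0) (𝓝 x) := by
    have := (hψ x 0).continuousAt.tendsto
    simp only [hψ0, id] at this
    exact this.mono_left nhdsWithin_le_nhds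
  have hlim : Tendsto (fun p : ℝ × ℝ => φ p.2 (ψ p.1 x)) (𝓝[≥] 0 ×ˢ 𝓝[≥] 0) (𝓝 x) :=
    (tendsto_flow_nhdsGE_prod_nhds hX.continuous.continuousAt hφ0 hφ).comp
      (tendsto_snd.prodMk (hψx.comp tendsto_fst))
  have hFs : ∀ s t, HasDerivAt (fun s => φ t (ψ s x)) (Y (φ t (ψ s x))) s := fun s t => by
    simpa only [hcomm'] using hψ (φ t x) s
  have hXd : Differentiable ℝ X := hX.differentiable one_ne_zero
  have hYd : Differentiable ℝ Y := hY.differentiable one_ne_zero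
  have hDXY : Continuous fun z => fderiv ℝ X z (Y z) :=
    (hX.continuous_fderiv one_ne_zero).clm_apply hY.continuous
  have hDYX : Continuous fun z => fderiv ℝ Y z (X z) :=
    (hY.continuous_fderiv one_ne_zero).clm_apply hX.continuous
  refine sub_eq_zero.2 (eq_of_tendsto_mixed_partials (F := fun s t => φ t (ψ s x))
    (fun s t => hφ (ψ s x) t)
    (fun s t => (hXd _).hasFDerivAt.comp_hasDerivAt s (hFs s t))
    ((hDXY.tendsto x).comp hlim) hFs
    (fun s t => (hYd _).hasFDerivAt.comp_hasDerivAt t (hφ (ψ s x) t))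
    ((hDYX.tendsto x).comp hlim)).symm
end

section
/- Let N be a positive integer, let E = Fin N → ℝ with its standard normed space structure and standard basis vectors e_1, …, e_N, and let U ⊆ E be an open set. Let X_1, …, X_N : E → E be smooth (infinitely continuously differentiable) vector fields on a neighborhood of U such that (i) at every x ∈ U the vectors X_1(x), …, X_N(x) are linearly independent, and (ii) the fields pairwise commute on U: D X_j(x)(X_i(x)) − D X_i(x)(X_j(x)) = 0 for all i, j and all x ∈ U. Then for every z ∈ U there exist an open set V with z ∈ V ⊆ U and a smooth map g : E → E that is injective on V, satisfies g(z) = 0, has invertible Fréchet derivative D g(x) at every x ∈ V, and satisfies D g(x)(X_i(x)) = e_i for all x ∈ V and all i = 1, …, N; that is, g is a coordinate chart centered at z whose i-th coordinate vector field equals X_i. -/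
open Filter Topology Metric

/-- A `1`-form taking constant values on pairwise commuting vector fields which span the space at
`x` is closed at `x`. -/
theorem fderiv_symmetric_of_eventually_const_of_commute
    {E F ι : Type*} [NormedAddCommGroup E] [NormedSpace ℝ E]
    [NormedAddCommGroup F] [NormedSpace ℝ F]
    {ω : E → E →L[ℝ] F} {X : ι → E → E} {c : ι → F} {x : E}
    (hω : DifferentiableAt ℝ ω x) (hX : ∀ i, DifferentiableAt ℝ (X i) x)
    (hc : ∀ i, ∀ᶠ y in 𝓝 x, ω y (X i y) = c i)
    (hspan : Submodule.span ℝ (Set.range fun i => X i x) = ⊤)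
    (hcomm : ∀ i j, fderiv ℝ (X j) x (X i x) = fderiv ℝ (X i) x (X j x)) (u v : E) :
    fderiv ℝ ω x u v = fderiv ℝ ω x v u := by
  have key (j : ι) (w : E) : fderiv ℝ ω x w (X j x) = - ω x (fderiv ℝ (X j) x w) := by
    have h₁ : HasFDerivAt (fun y => ω y (X j y)) (0 : E →L[ℝ] F) x :=
      (hasFDerivAt_const (c j) x).congr_of_eventuallyEq (hc j)
    have h₂ := (hω.hasFDerivAt.clm_apply (hX j).hasFDerivAt).unique h₁
    have h₃ := congrArg (fun L : E →L[ℝ] F => L w) h₂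
    simp only [add_apply, ContinuousLinearMap.comp_apply, ContinuousLinearMap.flip_apply,
      zero_apply] at h₃
    exact eq_neg_of_add_eq_zero_right h₃
  have hframe (i : ι) (w : E) : fderiv ℝ ω x (X i x) w = fderiv ℝ ω x w (X i x) := by
    have hw : w ∈ Submodule.span ℝ (Set.range fun i => X i x) := hspan ▸ Submodule.mem_top
    induction hw using Submodule.span_induction with
    | mem w hw => obtain ⟨j, rfl⟩ := hw; simp only [key, hcomm i j]
    | zero => simp
    | add a b _ _ ha hb => simp [ha, hb]
    | smul t a _ ha => simp [ha]
  have hu : u ∈ Submodule.span ℝ (Set.range fun i => X i x) := hspan ▸ Submodule.mem_top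
  induction hu using Submodule.span_induction with
  | mem u hu => obtain ⟨i, rfl⟩ := hu; exact hframe i v
  | zero => simp
  | add a b _ _ ha hb => simp [ha, hb]
  | smul t a _ ha => simp [ha]

/-- A smooth frame on an open set admits a smooth dual coframe. -/
theorem exists_contDiffOn_coframe {ι E : Type*} [Fintype ι] [DecidableEq ι]
    [NormedAddCommGroup E] [NormedSpace ℝ E] [FiniteDimensional ℝ E]
    (hcard : Fintype.card ι = Module.finrank ℝ E) {n : WithTop ℕ∞} {U : Set E} {X : ι → E → E}
    (hX : ∀ i, ContDiffOn ℝ n (X i) U) (hindep : ∀ x ∈ U, LinearIndependent ℝ fun i => X i x) :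
    ∃ ω : E → E →L[ℝ] (ι → ℝ), ContDiffOn ℝ n ω U ∧
      ∀ x ∈ U, (ω x).IsInvertible ∧ ∀ i, ω x (X i x) = Pi.single i 1 := by
  have : CompleteSpace E := FiniteDimensional.complete ℝ E
  let A : E → (ι → ℝ) →L[ℝ] E := fun x =>
    ∑ i, (ContinuousLinearMap.proj (R := ℝ) (φ := fun _ : ι => ℝ) i).smulRight (X i x)
  have hA (x : E) (i : ι) : A x (Pi.single i 1) = X i x := by
    simp [A, Pi.single_apply]
  have hAinv (x : E) (hx : x ∈ U) : (A x).IsInvertible := by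
    have hspan := (hindep x hx).span_eq_top_of_card_eq_finrank' hcard
    let b := Module.Basis.mk (hindep x hx) hspan.ge
    refine ⟨b.equivFun.symm.toContinuousLinearEquiv, ?_⟩
    ext v
    simp [A, b, Module.Basis.equivFun_symm_apply]
  have hAsmooth : ContDiffOn ℝ n A U := by
    refine ContDiffOn.sum fun i _ => ?_
    exact contDiffOn_const.smulRight (hX i)
  refine ⟨fun x => (A x).inverse, fun x hx => ?_, fun x hx => ?_⟩
  · exact (hAinv x hx).contDiffAt_map_inverse.comp_contDiffWithinAt x (hAsmooth x hx)
  · obtain ⟨e, he⟩ := hAinv x hx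
    refine ⟨⟨e.symm, by simp [← he]⟩, fun i => ?_⟩
    change (A x).inverse (X i x) = _
    simp [← hA x i, ← he]

/-- A function which is smooth near a point agrees near that point with a globally smooth one. -/
theorem exists_contDiff_eventuallyEq {E F : Type*} [NormedAddCommGroup E] [NormedSpace ℝ E]
    [FiniteDimensional ℝ E] [NormedAddCommGroup F] [NormedSpace ℝ F] {n : ℕ∞} {f : E → F}
    {s : Set E} {z : E} (hs : IsOpen s) (hz : z ∈ s) (hf : ContDiffOn ℝ n f s) :
    ∃ g : E → F, ContDiff ℝ n g ∧ g =ᶠ[𝓝 z] f := by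
  obtain ⟨r, hr, hrs⟩ := Metric.isOpen_iff.1 hs z hz
  let φ : ContDiffBump z := ⟨r / 3, r / 2, by positivity, by linarith⟩
  have hφs : tsupport φ ⊆ s := by
    rw [φ.tsupport_eq]
    exact (closedBall_subset_ball (by change r / 2 < r; linarith)).trans hrs
  refine ⟨fun x => φ x • f x, contDiff_iff_contDiffAt.2 fun x => ?_, ?_⟩
  · by_cases hx : x ∈ tsupport φ
    · exact φ.contDiffAt.smul (hf.contDiffAt (hs.mem_nhds (hφs hx)))
    · refine contDiffAt_const (c := (0 : F)) |>.congr_of_eventuallyEq ?_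
      filter_upwards [notMem_tsupport_iff_eventuallyEq.1 hx] with y hy
      simp [hy]
  · filter_upwards [φ.eventuallyEq_one] with x hx
    simp [hx]


/-- Theorem 2 (canonical forms for commuting vector fields; Lee 9.46): if the
smooth vector fields `X 1, …, X N` on an open set `U ⊆ ℝ^N` are linearly
independent at every point and pairwise commuting, then around each `z ∈ U`
there is a coordinate chart `g` centered at `z` whose `i`-th coordinate vector
field equals `X i`, i.e. `D g(x) (X i x) = e i`. -/
theorem canonical_form_for_commuting_vector_fields
    (N : ℕ) (hN : 0 < N)
    (U : Set (Fin N → ℝ)) (hU : IsOpen U)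
    (X : Fin N → (Fin N → ℝ) → (Fin N → ℝ))
    (hsmooth : ∀ i, ContDiffOn ℝ (⊤ : ℕ∞) (X i) U)
    (hindep : ∀ x ∈ U, LinearIndependent ℝ (fun i => X i x))
    (hcomm : ∀ i j, ∀ x ∈ U,
      fderiv ℝ (X j) x (X i x) - fderiv ℝ (X i) x (X j x) = 0) :
    ∀ z ∈ U, ∃ V : Set (Fin N → ℝ), IsOpen V ∧ z ∈ V ∧ V ⊆ U ∧
      ∃ g : (Fin N → ℝ) → (Fin N → ℝ),
        ContDiff ℝ (⊤ : ℕ∞) g ∧ Set.InjOn g V ∧ g z = 0 ∧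
        ∀ x ∈ V, ∃ D : (Fin N → ℝ) ≃L[ℝ] (Fin N → ℝ),
          HasFDerivAt g (D : (Fin N → ℝ) →L[ℝ] (Fin N → ℝ)) x ∧
          ∀ i, D (X i x) = Pi.single i 1 := by
  intro z hz
  obtain ⟨ω, hω, hωX⟩ := exists_contDiffOn_coframe (by simp) hsmooth hindep
  obtain ⟨r, hr, hrU⟩ := Metric.isOpen_iff.1 hU z hz
  have hωd : DifferentiableOn ℝ ω U := hω.differentiableOn (by simp)
  obtain ⟨f, hf⟩ := (convex_ball z r).exists_forall_hasFDerivAt_of_fderiv_symmetric isOpen_ball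
    (hωd.mono hrU) fun x hx u v =>
      have hxU : U ∈ 𝓝 x := hU.mem_nhds (hrU hx)
      fderiv_symmetric_of_eventually_const_of_commute (c := fun i => Pi.single i 1)
        (hωd.differentiableAt hxU)
        (fun i => ((hsmooth i).differentiableOn (by simp)).differentiableAt hxU)
        (fun i => by filter_upwards [hxU] with y hy using (hωX y hy).2 i)
        ((hindep x (hrU hx)).span_eq_top_of_card_eq_finrank' (by simp))
        (fun i j => sub_eq_zero.1 (hcomm i j x (hrU hx))) u v
  have hfsmooth : ContDiffOn ℝ (⊤ : ℕ∞) f (ball z r) := by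
    rw [contDiffOn_infty_iff_fderiv_of_isOpen isOpen_ball]
    exact ⟨fun x hx => (hf x hx).differentiableAt.differentiableWithinAt,
      (hω.mono hrU).congr fun x hx => (hf x hx).fderiv⟩
  obtain ⟨g, hg, hgf⟩ := exists_contDiff_eventuallyEq isOpen_ball (mem_ball_self hr)
    (hfsmooth.sub (contDiffOn_const (c := f z)))
  have hgω : ∀ᶠ x in 𝓝 z, HasFDerivAt g (ω x) x := by
    filter_upwards [hgf.eventually_nhds, isOpen_ball.mem_nhds (mem_ball_self hr)] with x hx hxr
    exact ((hf x hxr).sub_const (f z)).congr_of_eventuallyEq hx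
  obtain ⟨D, hD⟩ := (hωX z hz).1
  have hstrict : HasStrictFDerivAt g (D : (Fin N → ℝ) →L[ℝ] (Fin N → ℝ)) z :=
    hg.contDiffAt.hasStrictFDerivAt' (hD ▸ hgω.self_of_nhds) (by simp)
  let e := hstrict.toOpenPartialHomeomorph g
  obtain ⟨V, hV, hVo, hzV⟩ := _root_.eventually_nhds_iff.1 <|
    hgω.and <| (hU.eventually_mem hz).and <|
      e.open_source.eventually_mem hstrict.mem_toOpenPartialHomeomorph_source
  refine ⟨V, hVo, hzV, fun x hx => (hV x hx).2.1, g, hg, ?_, ?_, fun x hx => ?_⟩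
  · exact e.injOn.mono fun x hx => (hV x hx).2.2
  · simpa using hgf.self_of_nhds
  · obtain ⟨hgx, hxU, -⟩ := hV x hx
    obtain ⟨⟨L, hL⟩, hLX⟩ := hωX x hxU
    exact ⟨L, hL ▸ hgx, fun i => by rw [← hLX i, ← hL]; rfl⟩
end
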